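/- arXiv:1912.04863 — 2 statements merged into one kernel-verified Lean document; each statement's English description precedes it below -/
import Mathlib

section
/- Let n be a natural number, let u : ℝⁿ → ℝ be lower semicontinuous and bounded below, and let T > 0. Define û(0,x) = u(x) and û(t,x) = ⨅_{y ∈ ℝⁿ} ( u(y) + ‖x − y‖²/(2t) ) for t > 0. Then Σ_T(û) ⊆ Cut_T(û), and Cut_T(û) is contained in the closure of Σ_T(û) taken inside (0,T) × ℝⁿ. -/
open Metric Set intervalIntegral

/-- The negative Lax–Oleinik (Hopf–Lax) evolution of `u` for the quadratic Hamiltonian: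
`û(0,x) = u(x)` and `û(t,x) = inf_y ( u(y) + ‖x - y‖²/(2t) )` for `t > 0`
(values for `t < 0` are irrelevant). -/
noncomputable def hatu (n : ℕ) (u : EuclideanSpace ℝ (Fin n) → ℝ) (t : ℝ)
    (x : EuclideanSpace ℝ (Fin n)) : ℝ :=
  if 0 < t then ⨅ y : EuclideanSpace ℝ (Fin n), (u y + ‖x - y‖ ^ 2 / (2 * t)) else u x

/-- The set `Σ_T(û)` of singularities of `û` in `(0,T) × ℝⁿ`. -/
def sigmaT (n : ℕ) (u : EuclideanSpace ℝ (Fin n) → ℝ) (T : ℝ) :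
    Set (ℝ × EuclideanSpace ℝ (Fin n)) :=
  {p | p.1 ∈ Set.Ioo 0 T ∧
    ¬ DifferentiableAt ℝ (fun q : ℝ × EuclideanSpace ℝ (Fin n) => hatu n u q.1 q.2) p}

/-- The cut locus `Cut_T(û)`: points `(t,x) ∈ (0,T) × ℝⁿ` such that every `û`-calibrated
`C¹` curve `δ : [a,b] → ℝⁿ` with `0 ≤ a ≤ t ≤ b < T`, `a < b` and `δ(t) = x` has `t = b`. -/
def cutT (n : ℕ) (u : EuclideanSpace ℝ (Fin n) → ℝ) (T : ℝ) :
    Set (ℝ × EuclideanSpace ℝ (Fin n)) :=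
  {p | p.1 ∈ Set.Ioo 0 T ∧
    ∀ (a b : ℝ) (δ δ' : ℝ → EuclideanSpace ℝ (Fin n)),
      0 ≤ a → a < b → a ≤ p.1 → p.1 ≤ b → b < T →
      (∀ s ∈ Set.Icc a b, HasDerivAt δ (δ' s) s) →
      ContinuousOn δ' (Set.Icc a b) → δ p.1 = p.2 →
      hatu n u b (δ b) = hatu n u a (δ a) + (∫ s in a..b, (1 / 2) * ‖δ' s‖ ^ 2) →
      p.1 = b}

theorem hatu_le' {n : ℕ} {u : EuclideanSpace ℝ (Fin n) → ℝ}
    (hb : BddBelow (Set.range u)) {t : ℝ} (ht : 0 < t) (x y : EuclideanSpace ℝ (Fin n)) :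
    hatu n u t x ≤ u y + ‖x - y‖ ^ 2 / (2 * t) := by
  unfold hatu
  rw [if_pos ht]
  obtain ⟨m, hm⟩ := hb
  refine ciInf_le ⟨m, ?_⟩ y
  rintro _ ⟨z, rfl⟩
  have h1 : m ≤ u z := hm ⟨z, rfl⟩
  have h2 : 0 ≤ ‖x - z‖ ^ 2 / (2 * t) := by positivity
  show m ≤ u z + ‖x - z‖ ^ 2 / (2 * t)
  linarith

theorem le_hatu' {n : ℕ} {u : EuclideanSpace ℝ (Fin n) → ℝ}
    {t : ℝ} (ht : 0 < t) (x : EuclideanSpace ℝ (Fin n)) (c : ℝ)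
    (h : ∀ y, c ≤ u y + ‖x - y‖ ^ 2 / (2 * t)) : c ≤ hatu n u t x := by
  unfold hatu
  rw [if_pos ht]
  exact le_ciInf h

theorem exists_minimizer {n : ℕ} {u : EuclideanSpace ℝ (Fin n) → ℝ}
    (hlsc : LowerSemicontinuous u)
    (hb : BddBelow (Set.range u)) {t : ℝ} (ht : 0 < t) (x : EuclideanSpace ℝ (Fin n)) :
    ∃ y, hatu n u t x = u y + ‖x - y‖ ^ 2 / (2 * t) := by
  obtain ⟨m, hm⟩ := id hb
  have hm' : ∀ z, m ≤ u z := fun z => hm ⟨z, rfl⟩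
  set R : ℝ := Real.sqrt (2 * t * (u x - m)) with hR
  have hR0 : 0 ≤ R := Real.sqrt_nonneg _
  have hR2 : R ^ 2 = 2 * t * (u x - m) :=
    Real.sq_sqrt (mul_nonneg (by positivity) (by linarith [hm' x]))
  have hl : LowerSemicontinuous (fun y => u y + ‖x - y‖ ^ 2 / (2 * t)) := by
    refine hlsc.add (Continuous.lowerSemicontinuous ?_)
    fun_prop
  obtain ⟨y, hy, hmin⟩ := LowerSemicontinuousOn.exists_isMinOn
    (s := closedBall x R) ⟨x, mem_closedBall_self hR0⟩ (isCompact_closedBall x R)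
    (hl.lowerSemicontinuousOn _)
  refine ⟨y, le_antisymm (hatu_le' hb ht x y) (le_hatu' ht x _ fun z => ?_)⟩
  by_cases hz : z ∈ closedBall x R
  · exact hmin hz
  · have h1 : u y + ‖x - y‖ ^ 2 / (2 * t) ≤ u x + ‖x - x‖ ^ 2 / (2 * t) :=
      hmin (mem_closedBall_self hR0)
    have h2 : R < ‖x - z‖ := by
      rw [mem_closedBall, not_le, dist_comm, dist_eq_norm] at hz
      exact hz
    have h3 : R ^ 2 ≤ ‖x - z‖ ^ 2 := by gcongr
    have h4 : u x - m ≤ ‖x - z‖ ^ 2 / (2 * t) := by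
      rw [le_div_iff₀ (by positivity)]
      nlinarith
    simp at h1
    linarith [hm' z]

theorem conv_norm {n : ℕ} {s r : ℝ} (hs : 0 < s) (hr : 0 < r) (p q : EuclideanSpace ℝ (Fin n)) :
    ‖p + q‖ ^ 2 / (2 * (s + r)) ≤ ‖p‖ ^ 2 / (2 * s) + ‖q‖ ^ 2 / (2 * r) := by
  have h1 : ‖p + q‖ ^ 2 ≤ (‖p‖ + ‖q‖) ^ 2 := by
    gcongr
    exact norm_add_le p q
  have h2 : ‖p‖ ^ 2 / (2 * s) + ‖q‖ ^ 2 / (2 * r) - (‖p‖ + ‖q‖) ^ 2 / (2 * (s + r))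
      = (r * ‖p‖ - s * ‖q‖) ^ 2 / (2 * s * r * (s + r)) := by
    field_simp
    ring
  have h3 : 0 ≤ (r * ‖p‖ - s * ‖q‖) ^ 2 / (2 * s * r * (s + r)) := by positivity
  have h4 : ‖p + q‖ ^ 2 / (2 * (s + r)) ≤ (‖p‖ + ‖q‖) ^ 2 / (2 * (s + r)) := by gcongr
  linarith

theorem semigroup_le {n : ℕ} {u : EuclideanSpace ℝ (Fin n) → ℝ}
    (hb : BddBelow (Set.range u)) {s b : ℝ} (hs : 0 ≤ s) (hsb : s < b)
    (z w : EuclideanSpace ℝ (Fin n)) :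
    hatu n u b w ≤ hatu n u s z + ‖w - z‖ ^ 2 / (2 * (b - s)) := by
  have hb0 : 0 < b := by linarith
  rcases hs.eq_or_lt with rfl | hs
  · have : hatu n u 0 z = u z := by simp [hatu]
    rw [this, sub_zero]
    exact hatu_le' hb hb0 w z
  · rw [← sub_le_iff_le_add]
    refine le_hatu' hs z _ fun y => ?_
    have h1 := hatu_le' hb hb0 w y
    have h2 := conv_norm hs (sub_pos.2 hsb) (z - y) (w - z)
    rw [show z - y + (w - z) = w - y by abel, show s + (b - s) = b by ring] at h2
    linarith

theorem action_ge {n : ℕ} {a b : ℝ} (hab : a < b) (δ δ' : ℝ → EuclideanSpace ℝ (Fin n))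
    (hd : ∀ s ∈ Set.Icc a b, HasDerivAt δ (δ' s) s) (hc : ContinuousOn δ' (Set.Icc a b)) :
    ‖δ b - δ a‖ ^ 2 / (2 * (b - a)) ≤ ∫ s in a..b, (1 / 2) * ‖δ' s‖ ^ 2 := by
  have hba : 0 < b - a := sub_pos.2 hab
  set c : EuclideanSpace ℝ (Fin n) := (b - a)⁻¹ • (δ b - δ a) with hcdef
  have hu : uIcc a b = Icc a b := uIcc_of_le hab.le
  have hi1 : IntervalIntegrable (fun s => inner ℝ c (δ' s) - ‖c‖ ^ 2 / 2) MeasureTheory.volume a b := by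
    apply ContinuousOn.intervalIntegrable
    rw [hu]
    fun_prop
  have hi2 : IntervalIntegrable (fun s => (1 / 2) * ‖δ' s‖ ^ 2) MeasureTheory.volume a b := by
    apply ContinuousOn.intervalIntegrable
    rw [hu]
    fun_prop
  have h1 : ∫ s in a..b, (inner ℝ c (δ' s) - ‖c‖ ^ 2 / 2)
      = (inner ℝ c (δ b) - b * (‖c‖ ^ 2 / 2)) - (inner ℝ c (δ a) - a * (‖c‖ ^ 2 / 2)) := by
    refine integral_eq_sub_of_hasDerivAt (f := fun s => inner ℝ c (δ s) - s * (‖c‖ ^ 2 / 2))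
      (fun s hs => ?_) hi1
    rw [hu] at hs
    have e1 : HasDerivAt (fun s => inner ℝ c (δ s)) (inner ℝ c (δ' s)) s :=
      ((innerSL ℝ c).hasFDerivAt.comp_hasDerivAt s (hd s hs))
    have e2 : HasDerivAt (fun s : ℝ => s * (‖c‖ ^ 2 / 2)) (‖c‖ ^ 2 / 2) s := by
      simpa using (hasDerivAt_id s).mul_const (‖c‖ ^ 2 / 2)
    exact e1.sub e2
  have h2 : ∫ s in a..b, (inner ℝ c (δ' s) - ‖c‖ ^ 2 / 2) ≤ ∫ s in a..b, (1 / 2) * ‖δ' s‖ ^ 2 := by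
    refine integral_mono_on hab.le hi1 hi2 fun s _ => ?_
    have := norm_sub_sq_real c (δ' s)
    nlinarith [sq_nonneg ‖c - δ' s‖]
  refine le_trans (le_of_eq ?_) h2
  rw [h1]
  have e : δ b - δ a = (b - a) • c := by
    rw [hcdef, smul_smul, mul_inv_cancel₀ hba.ne', one_smul]
  have e3 : inner ℝ c (δ b) - inner ℝ c (δ a) = (b - a) * ‖c‖ ^ 2 := by
    rw [← inner_sub_right, e, inner_smul_right, real_inner_self_eq_norm_sq]
  have e4 : ‖δ b - δ a‖ ^ 2 = (b - a) ^ 2 * ‖c‖ ^ 2 := by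
    rw [e, norm_smul, mul_pow, Real.norm_eq_abs, sq_abs]
  rw [e4]
  have e5 : (b - a) ^ 2 * ‖c‖ ^ 2 / (2 * (b - a)) = (b - a) * ‖c‖ ^ 2 / 2 := by
    field_simp
  rw [e5]
  linarith

theorem squeeze_diff {F : Type*} [NormedAddCommGroup F] [NormedSpace ℝ F] {f g h : F → ℝ} {p : F}
    (hg : DifferentiableAt ℝ g p) (hh : DifferentiableAt ℝ h p)
    (hgf : ∀ᶠ q in nhds p, g q ≤ f q) (hfh : ∀ᶠ q in nhds p, f q ≤ h q)
    (e1 : g p = f p) (e2 : h p = f p) : DifferentiableAt ℝ f p := by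
  have hmin : IsLocalMin (h - g) p := by
    filter_upwards [hgf, hfh] with q h1 h2
    simp only [Pi.sub_apply]
    linarith
  have h0 := hmin.fderiv_eq_zero
  rw [fderiv_sub hh hg, sub_eq_zero] at h0
  have hg' := hg.hasFDerivAt
  have hh' := hh.hasFDerivAt
  rw [h0] at hh'
  refine ⟨fderiv ℝ g p, ?_⟩
  rw [hasFDerivAt_iff_isLittleO] at *
  rw [Asymptotics.isLittleO_iff] at *
  intro c hc
  filter_upwards [hg' hc, hh' hc, hgf, hfh] with q a1 a2 a3 a4
  rw [Real.norm_eq_abs, abs_le] at *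
  constructor
  · linarith
  · linarith

theorem diff_div_aux {F : Type*} [NormedAddCommGroup F] [NormedSpace ℝ F] {f g : F → ℝ} {p : F}
    (hf : DifferentiableAt ℝ f p) (hg : DifferentiableAt ℝ g p) (h0 : g p ≠ 0) :
    DifferentiableAt ℝ (fun q => f q / g q) p := by
  simp only [div_eq_mul_inv]
  exact hf.mul (hg.inv h0)

theorem part_one {n : ℕ} {u : EuclideanSpace ℝ (Fin n) → ℝ} (hlsc : LowerSemicontinuous u)
    (hb : BddBelow (Set.range u)) {a b t : ℝ} (x : EuclideanSpace ℝ (Fin n))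
    (δ δ' : ℝ → EuclideanSpace ℝ (Fin n)) (ha : 0 ≤ a) (ht : 0 < t) (hat : a ≤ t) (htb : t < b)
    (hd : ∀ s ∈ Set.Icc a b, HasDerivAt δ (δ' s) s) (hc : ContinuousOn δ' (Set.Icc a b))
    (hx : δ t = x)
    (hcal : hatu n u b (δ b) = hatu n u a (δ a) + (∫ s in a..b, (1 / 2) * ‖δ' s‖ ^ 2)) :
    DifferentiableAt ℝ (fun q : ℝ × EuclideanSpace ℝ (Fin n) => hatu n u q.1 q.2) (t, x) := by
  obtain ⟨y, hy⟩ := exists_minimizer hlsc hb ht x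
  have s1 : Icc a t ⊆ Icc a b := Icc_subset_Icc_right htb.le
  have s2 : Icc t b ⊆ Icc a b := Icc_subset_Icc_left hat
  have hii : ∀ c d, c ≤ d → Icc c d ⊆ Icc a b →
      IntervalIntegrable (fun s => (1 / 2) * ‖δ' s‖ ^ 2) MeasureTheory.volume c d := by
    intro c d hcd hs
    apply ContinuousOn.intervalIntegrable
    rw [uIcc_of_le hcd]
    have := hc.mono hs
    fun_prop
  have hsplit := integral_add_adjacent_intervals (hii a t hat s1) (hii t b htb.le s2)
  have k1 : hatu n u t x ≤ hatu n u a (δ a) + ∫ s in a..t, (1 / 2) * ‖δ' s‖ ^ 2 := by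
    rcases hat.eq_or_lt with rfl | hat
    · simp [hx]
    · have := semigroup_le hb ha hat (δ a) (δ t)
      have := action_ge hat δ δ' (fun s hs => hd s (s1 hs)) (hc.mono s1)
      rw [← hx]
      linarith
  have k2 := action_ge htb δ δ' (fun s hs => hd s (s2 hs)) (hc.mono s2)
  have k3 := semigroup_le hb ht.le htb x (δ b)
  rw [hx] at k2
  have k4 : hatu n u b (δ b) = hatu n u t x + ‖δ b - x‖ ^ 2 / (2 * (b - t)) := by
    linarith
  have hbt : b - t ≠ 0 := by linarith
  have n1 : ∀ᶠ q : ℝ × EuclideanSpace ℝ (Fin n) in nhds (t, x), 0 < q.1 :=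
    continuousAt_fst.eventually (lt_mem_nhds ht)
  have n2 : ∀ᶠ q : ℝ × EuclideanSpace ℝ (Fin n) in nhds (t, x), q.1 < b :=
    continuousAt_fst.eventually (gt_mem_nhds htb)
  refine squeeze_diff
    (g := fun q : ℝ × EuclideanSpace ℝ (Fin n) =>
      hatu n u b (δ b) - ‖δ b - q.2‖ ^ 2 / (2 * (b - q.1)))
    (h := fun q : ℝ × EuclideanSpace ℝ (Fin n) => u y + ‖q.2 - y‖ ^ 2 / (2 * q.1))
    ?_ ?_ ?_ ?_ ?_ ?_
  · refine (differentiableAt_const _).sub (diff_div_aux ?_ ?_ ?_)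
    · exact DifferentiableAt.norm_sq ℝ (by fun_prop)
    · fun_prop
    · simpa using hbt
  · refine (differentiableAt_const _).add (diff_div_aux ?_ ?_ ?_)
    · exact DifferentiableAt.norm_sq ℝ (by fun_prop)
    · fun_prop
    · simpa using ht.ne'
  · filter_upwards [n1, n2] with q q1 q2
    have := semigroup_le hb q1.le q2 q.2 (δ b)
    linarith
  · filter_upwards [n1] with q q1
    exact hatu_le' hb q1 q.2 y
  · show _ - _ = hatu n u t x
    simp only
    linarith
  · exact hy.symm

theorem part_two {n : ℕ} {u : EuclideanSpace ℝ (Fin n) → ℝ} (hlsc : LowerSemicontinuous u)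
    (hb : BddBelow (Set.range u)) {T t : ℝ} (ht : 0 < t) (htT : t < T)
    (x : EuclideanSpace ℝ (Fin n)) (hcut : (t, x) ∈ cutT n u T) :
    (t, x) ∈ closure (sigmaT n u T) := by
  by_contra hcl
  obtain ⟨r, hr, hball⟩ := Metric.isOpen_iff.1 isClosed_closure.isOpen_compl (t, x) hcl
  have hdiff : ∀ τ z, |τ - t| < r → ‖z - x‖ < r → 0 < τ → τ < T →
      DifferentiableAt ℝ (fun z => hatu n u τ z) z := by
    intro τ z h1 h2 h3 h4
    have hm : (τ, z) ∈ ball (t, x) r := by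
      rw [mem_ball, Prod.dist_eq, max_lt_iff, Real.dist_eq, dist_eq_norm]
      exact ⟨h1, h2⟩
    have hns : (τ, z) ∉ sigmaT n u T := fun h => hball hm (subset_closure h)
    have hd : DifferentiableAt ℝ
        (fun q : ℝ × EuclideanSpace ℝ (Fin n) => hatu n u q.1 q.2) (τ, z) := by
      by_contra hnd
      exact hns ⟨⟨h3, h4⟩, hnd⟩
    exact DifferentiableAt.comp (f := fun z => (τ, z)) z hd (by fun_prop)
  obtain ⟨m, hm⟩ := id hb
  have hm' : ∀ z, m ≤ u z := fun z => hm ⟨z, rfl⟩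
  set ρ := r / 2 with hρ
  have hρ0 : 0 < ρ := by positivity
  obtain ⟨ε, hε0, hε1, hε2, hε3⟩ : ∃ ε : ℝ, 0 < ε ∧ ε < r ∧ t + ε < T ∧
      2 * (u x - m) * (ε * (t + ε)) < ρ ^ 2 * t := by
    have hcont : Filter.Tendsto (fun ε : ℝ => 2 * (u x - m) * (ε * (t + ε))) (nhds 0) (nhds 0) := by
      have : Continuous (fun ε : ℝ => 2 * (u x - m) * (ε * (t + ε))) := by fun_prop
      simpa using this.tendsto 0
    have e1 := hcont.eventually (gt_mem_nhds (show (0:ℝ) < ρ ^ 2 * t by positivity))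
    have e2 : ∀ᶠ ε : ℝ in nhds 0, ε < r := gt_mem_nhds hr
    have e3 : ∀ᶠ ε : ℝ in nhds 0, ε < T - t := gt_mem_nhds (by linarith)
    have e4 : ∀ᶠ ε : ℝ in nhdsWithin 0 (Ioi 0), 0 < ε := self_mem_nhdsWithin
    obtain ⟨ε, h1, h2⟩ := (((e1.and (e2.and e3)).filter_mono nhdsWithin_le_nhds).and e4).exists
    exact ⟨ε, h2, h1.2.1, by linarith [h1.2.2], h1.1⟩
  set τ := t + ε with hτ
  have hτ0 : 0 < τ := by positivity
  have hdz : ∀ z, ‖z - x‖ < r → DifferentiableAt ℝ (fun z => hatu n u τ z) z := fun z hz =>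
    hdiff τ z (by rw [hτ, add_sub_cancel_left, abs_of_pos hε0]; exact hε1) hz hτ0 hε2
  have hfd : ∀ z, ‖z - x‖ < r →
      DifferentiableAt ℝ (fun z => hatu n u τ z - ‖z - x‖ ^ 2 / (2 * ε)) z := fun z hz =>
    (hdz z hz).sub (by
      have h1 : DifferentiableAt ℝ (fun z : EuclideanSpace ℝ (Fin n) => ‖z - x‖ ^ 2) z :=
        DifferentiableAt.norm_sq ℝ (by fun_prop)
      simpa only [div_eq_mul_inv] using h1.mul_const ((2 * ε)⁻¹))
  have hin : ∀ z ∈ closedBall x ρ, ‖z - x‖ < r := by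
    intro z hz
    rw [mem_closedBall, dist_eq_norm] at hz
    linarith
  obtain ⟨z₀, hz₀, hmax⟩ := (isCompact_closedBall x ρ).exists_isMaxOn
    ⟨x, mem_closedBall_self hρ0.le⟩
    (f := fun z => hatu n u τ z - ‖z - x‖ ^ 2 / (2 * ε))
    (fun z hz => (hfd z (hin z hz)).continuousAt.continuousWithinAt)
  have hz₀r := hin z₀ hz₀
  have hfx : m ≤ hatu n u τ z₀ - ‖z₀ - x‖ ^ 2 / (2 * ε) := by
    have h1 : hatu n u τ x - ‖x - x‖ ^ 2 / (2 * ε) ≤ hatu n u τ z₀ - ‖z₀ - x‖ ^ 2 / (2 * ε) :=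
      hmax (mem_closedBall_self hρ0.le)
    have h2 : m ≤ hatu n u τ x := le_hatu' hτ0 x m fun y => by
      have : 0 ≤ ‖x - y‖ ^ 2 / (2 * τ) := by positivity
      linarith [hm' y]
    simp at h1
    linarith
  have hlt : z₀ ∈ ball x ρ := by
    rw [mem_closedBall, dist_eq_norm] at hz₀
    rw [mem_ball, dist_eq_norm]
    refine lt_of_le_of_ne hz₀ fun heq => ?_
    have h1 := hatu_le' hb hτ0 z₀ x
    rw [heq] at h1 hfx
    have h2 : ρ ^ 2 / (2 * ε) - ρ ^ 2 / (2 * τ) = ρ ^ 2 * t / (2 * (ε * τ)) := by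
      rw [hτ]
      field_simp
      ring
    have h3 : u x - m < ρ ^ 2 * t / (2 * (ε * τ)) := by
      rw [lt_div_iff₀ (by positivity)]
      linarith
    linarith
  have hloc : IsLocalMax (fun z => hatu n u τ z - ‖z - x‖ ^ 2 / (2 * ε)) z₀ :=
    hmax.isLocalMax (Filter.mem_of_superset (isOpen_ball.mem_nhds hlt) ball_subset_closedBall)
  obtain ⟨y, hy⟩ := exists_minimizer hlsc hb hτ0 z₀
  have hloc2 : IsLocalMax (fun z => hatu n u τ z - ‖z - y‖ ^ 2 / (2 * τ)) z₀ := by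
    refine Filter.Eventually.of_forall fun z => ?_
    have := hatu_le' hb hτ0 z y
    simp only
    linarith
  have hF := (hdz z₀ hz₀r).hasFDerivAt
  have hN : ∀ (w : EuclideanSpace ℝ (Fin n)) (c : ℝ),
      HasFDerivAt (fun z => ‖z - w‖ ^ 2 / (2 * c)) ((2 * c)⁻¹ • (2 • innerSL ℝ (z₀ - w))) z₀ := by
    intro w c
    have h1 : HasFDerivAt (fun z => ‖z - w‖ ^ 2) (2 • innerSL ℝ (z₀ - w)) z₀ := by
      have := ((hasFDerivAt_id (𝕜 := ℝ) z₀).sub_const w).norm_sq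
      simpa using this
    have h2 := h1.mul_const ((2 * c)⁻¹)
    simpa only [div_eq_mul_inv] using h2
  have g1 := hloc.hasFDerivAt_eq_zero (hF.sub (hN x ε))
  have g2 := hloc2.hasFDerivAt_eq_zero (hF.sub (hN y τ))
  have g3 : ε⁻¹ • (z₀ - x) = τ⁻¹ • (z₀ - y) := by
    refine ext_inner_right ℝ fun v => ?_
    have a1 := congrArg (fun L => L v) (sub_eq_zero.1 g1)
    have a2 := congrArg (fun L => L v) (sub_eq_zero.1 g2)
    have a3 := a1.symm.trans a2
    simp only [ContinuousLinearMap.smul_apply, innerSL_apply_apply, smul_eq_mul, nsmul_eq_mul,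
      mul_inv] at a3
    rw [real_inner_smul_left, real_inner_smul_left]
    push_cast at a3
    linarith
  have g4 : x = y + t • (τ⁻¹ • (z₀ - y)) := by
    have b1 : z₀ - x = ε • (τ⁻¹ • (z₀ - y)) := by
      rw [← g3, smul_smul, mul_inv_cancel₀ hε0.ne', one_smul]
    have b2 : z₀ - y = τ • (τ⁻¹ • (z₀ - y)) := by
      rw [smul_smul, mul_inv_cancel₀ hτ0.ne', one_smul]
    have b3 : τ • (τ⁻¹ • (z₀ - y)) = t • (τ⁻¹ • (z₀ - y)) + ε • (τ⁻¹ • (z₀ - y)) := by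
      rw [← add_smul]
    rw [b3, ← b1] at b2
    have : x = y + (z₀ - y - (z₀ - x)) := by abel
    rw [this]
    congr 1
    rw [sub_eq_iff_eq_add]
    exact b2
  set c := τ⁻¹ • (z₀ - y) with hc
  have hcτ : y + τ • c = z₀ := by
    rw [hc, smul_smul, mul_inv_cancel₀ hτ0.ne', one_smul]
    abel
  have hfin := hcut.2 0 τ (fun s => y + s • c) (fun _ => c) le_rfl hτ0 ht.le
    (by show t ≤ τ; linarith) hε2 (fun s _ => ?_) continuousOn_const g4.symm ?_
  · have : t = τ := hfin
    linarith
  · simpa using ((hasDerivAt_id s).smul_const c).const_add y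
  · simp only [hcτ, zero_smul, add_zero, intervalIntegral.integral_const, sub_zero, smul_eq_mul]
    rw [hy]
    have h0 : hatu n u 0 y = u y := by simp [hatu]
    have h1 : ‖z₀ - y‖ ^ 2 = τ ^ 2 * ‖c‖ ^ 2 := by
      rw [← hcτ, add_sub_cancel_left, norm_smul, mul_pow, Real.norm_eq_abs, sq_abs]
    rw [h0, h1]
    field_simp

/-- For `u` lower semicontinuous and bounded below:
`Σ_T(û) ⊆ Cut_T(û)` and `Cut_T(û)` is contained in the closure of `Σ_T(û)`
taken inside `(0,T) × ℝⁿ`. -/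
theorem sigmaT_subset_cutT_subset_closure (n : ℕ)
    (u : EuclideanSpace ℝ (Fin n) → ℝ) (hlsc : LowerSemicontinuous u)
    (hb : BddBelow (Set.range u)) (T : ℝ) (hT : 0 < T) :
    sigmaT n u T ⊆ cutT n u T ∧
    cutT n u T ⊆
      closure (sigmaT n u T) ∩ {p : ℝ × EuclideanSpace ℝ (Fin n) | p.1 ∈ Set.Ioo 0 T} := by
  refine ⟨?_, ?_⟩
  · rintro ⟨t, x⟩ ⟨ht, hnd⟩
    refine ⟨ht, fun a b δ δ' ha _ hat htb _ hd hc hx hcal => ?_⟩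
    by_contra hne
    exact hnd (part_one hlsc hb x δ δ' ha ht.1 hat (lt_of_le_of_ne htb hne) hd hc hx hcal)
  · rintro ⟨t, x⟩ h
    exact ⟨part_two hlsc hb h.1.1 h.1.2 x h, h.1⟩
end

section
/- Let n be a natural number, let u : ℝⁿ → ℝ be lower semicontinuous and bounded below, and let T > 0. Define û(0,x) = u(x) and û(t,x) = ⨅_{y ∈ ℝⁿ} ( u(y) + ‖x − y‖²/(2t) ) for t > 0, and define the cut time function τ : (0,T) × ℝⁿ → ℝ by τ(t,x) = sup { t' ∈ [t, T) : there exists an û-calibrated continuously differentiable curve γ : [0,t'] → ℝⁿ with γ(t) = x }. Then for every (t,x) ∈ (0,T) × ℝⁿ the set defining τ(t,x) is nonempty (so t ≤ τ(t,x) ≤ T), and τ is upper semicontinuous on (0,T) × ℝⁿ. -/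
open Metric Set intervalIntegral

/-- The set of times `t' ∈ [t, T)` such that some `û`-calibrated `C¹` curve
`γ : [0,t'] → ℝⁿ` passes through `x` at time `t`. -/
def calibTimes (n : ℕ) (u : EuclideanSpace ℝ (Fin n) → ℝ) (T : ℝ)
    (p : ℝ × EuclideanSpace ℝ (Fin n)) : Set ℝ :=
  {t' | p.1 ≤ t' ∧ t' < T ∧
    ∃ γ γ' : ℝ → EuclideanSpace ℝ (Fin n),
      (∀ s ∈ Set.Icc (0 : ℝ) t', HasDerivAt γ (γ' s) s) ∧
      ContinuousOn γ' (Set.Icc (0 : ℝ) t') ∧ γ p.1 = p.2 ∧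
      hatu n u t' (γ t') = hatu n u 0 (γ 0) + ∫ s in (0 : ℝ)..t', (1 / 2) * ‖γ' s‖ ^ 2}

/-- The cut time function `τ(t,x)` of `û`. -/
noncomputable def cutTime (n : ℕ) (u : EuclideanSpace ℝ (Fin n) → ℝ) (T : ℝ)
    (p : ℝ × EuclideanSpace ℝ (Fin n)) : ℝ :=
  sSup (calibTimes n u T p)

/-- Reduced calibration condition. -/
def redCal (n : ℕ) (u : EuclideanSpace ℝ (Fin n) → ℝ) (b t : ℝ)
    (x y : EuclideanSpace ℝ (Fin n)) : Prop :=
  ∀ w, u y ≤ u w + ‖y - w‖ ^ 2 / (2 * b) + inner ℝ (y - w) (x - y) / t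

theorem bdd_aux (n : ℕ) (u : EuclideanSpace ℝ (Fin n) → ℝ)
    (hb : BddBelow (Set.range u)) (b : ℝ) (hb0 : 0 < b) (z : EuclideanSpace ℝ (Fin n)) :
    BddBelow (Set.range fun y => u y + ‖z - y‖ ^ 2 / (2 * b)) := by
  obtain ⟨m, hm⟩ := hb
  refine ⟨m, ?_⟩
  rintro _ ⟨y, rfl⟩
  have h1 : m ≤ u y := hm ⟨y, rfl⟩
  have h2 : 0 ≤ ‖z - y‖ ^ 2 / (2 * b) := by positivity
  show m ≤ u y + ‖z - y‖ ^ 2 / (2 * b)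
  linarith

theorem norm_aux (n : ℕ) (b : ℝ) (hb0 : 0 < b) (c y w : EuclideanSpace ℝ (Fin n)) :
    ‖y + b • c - w‖ ^ 2 / (2 * b) =
      ‖y - w‖ ^ 2 / (2 * b) + inner ℝ (y - w) c + b / 2 * ‖c‖ ^ 2 := by
  have : y + b • c - w = (y - w) + b • c := by abel
  rw [this, norm_add_sq_real, inner_smul_right, norm_smul, Real.norm_eq_abs, mul_pow, sq_abs]
  field_simp

theorem redCal_of_mem (n : ℕ) (u : EuclideanSpace ℝ (Fin n) → ℝ)
    (hb : BddBelow (Set.range u)) (T b : ℝ) (p : ℝ × EuclideanSpace ℝ (Fin n))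
    (hp : 0 < p.1) (h : b ∈ calibTimes n u T p) : ∃ y, redCal n u b p.1 p.2 y := by
  obtain ⟨h1, h2, γ, γ', hd, hc, hx, hcal⟩ := h
  have hb0 : 0 < b := hp.trans_le h1
  have hu : uIcc 0 b = Icc 0 b := uIcc_of_le hb0.le
  set c := (1 / b) • (γ b - γ 0) with hcdef
  have hz : γ b = γ 0 + b • c := by
    rw [hcdef, smul_smul, mul_one_div_cancel hb0.ne', one_smul]; abel
  simp only [hatu, hb0, if_true, lt_irrefl, if_false] at hcal
  have hle := ciInf_le (bdd_aux n u hb b hb0 (γ b)) (γ 0)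
  set I := ∫ s in (0 : ℝ)..b, (1 / 2) * ‖γ' s‖ ^ 2 with hI
  have hi1 : IntervalIntegrable (fun s => (1 / 2) * ‖γ' s‖ ^ 2) MeasureTheory.volume 0 b := by
    apply ContinuousOn.intervalIntegrable; rw [hu]; fun_prop
  have hi2 : IntervalIntegrable (fun s => (inner ℝ c (γ' s) : ℝ)) MeasureTheory.volume 0 b := by
    apply ContinuousOn.intervalIntegrable; rw [hu]; fun_prop
  have hi3 : IntervalIntegrable (fun _ : ℝ => (1 / 2) * ‖c‖ ^ 2) MeasureTheory.volume 0 b :=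
    intervalIntegrable_const
  have hF : ∫ s in (0 : ℝ)..b, (inner ℝ c (γ' s) : ℝ) = inner ℝ c (γ b) - inner ℝ c (γ 0) := by
    apply integral_eq_sub_of_hasDerivAt (f := fun s => (inner ℝ c (γ s) : ℝ)) _ hi2
    intro s hs
    rw [hu] at hs
    simpa using (hasDerivAt_const s c).inner ℝ (hd s hs)
  have hJ : ∫ s in (0 : ℝ)..b, (1 / 2) * ‖γ' s - c‖ ^ 2 = I - b / 2 * ‖c‖ ^ 2 := by
    have : ∀ s, (1 / 2) * ‖γ' s - c‖ ^ 2 =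
        (1 / 2) * ‖γ' s‖ ^ 2 - inner ℝ c (γ' s) + (1 / 2) * ‖c‖ ^ 2 := by
      intro s
      rw [norm_sub_sq_real, real_inner_comm]; ring
    simp_rw [this]
    rw [integral_add (hi1.sub hi2) hi3, integral_sub hi1 hi2, hF, integral_const, ← hI, hz,
      inner_add_right, inner_smul_right, real_inner_self_eq_norm_sq]
    simp only [smul_eq_mul]
    ring
  have hkey := norm_aux n b hb0 c (γ 0) (γ 0)
  simp only [sub_self, norm_zero, inner_zero_left] at hkey
  rw [← hz] at hkey
  have hJ0 : ∫ s in (0 : ℝ)..b, (1 / 2) * ‖γ' s - c‖ ^ 2 ≤ 0 := by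
    rw [hJ]
    norm_num at hkey
    linarith
  have hall : ∀ s ∈ Icc 0 b, γ' s = c := by
    intro s hs
    by_contra hne
    have : 0 < ∫ s in (0 : ℝ)..b, (1 / 2) * ‖γ' s - c‖ ^ 2 := by
      apply integral_pos hb0 (by fun_prop) (fun _ _ => by positivity)
      refine ⟨s, hs, ?_⟩
      have := norm_pos_iff.2 (sub_ne_zero.2 hne)
      positivity
    linarith
  have hI' : I = b / 2 * ‖c‖ ^ 2 := by
    have : ∫ s in (0 : ℝ)..b, (1 / 2) * ‖γ' s - c‖ ^ 2 = ∫ s in (0 : ℝ)..b, (0 : ℝ) := by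
      apply integral_congr
      intro s hs
      rw [hu] at hs
      simp [hall s hs]
    rw [hJ] at this
    simp at this
    linarith
  have hxt : p.2 - γ 0 = p.1 • c := by
    have hu' : uIcc 0 p.1 = Icc 0 p.1 := uIcc_of_le hp.le
    have hsub : Icc 0 p.1 ⊆ Icc 0 b := Icc_subset_Icc_right h1
    have e1 : ∫ s in (0 : ℝ)..p.1, γ' s = γ p.1 - γ 0 := by
      apply integral_eq_sub_of_hasDerivAt
      · intro s hs
        rw [hu'] at hs
        exact hd s (hsub hs)
      · apply ContinuousOn.intervalIntegrable
        rw [hu']; exact hc.mono hsub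
    have e2 : ∫ s in (0 : ℝ)..p.1, γ' s = ∫ s in (0 : ℝ)..p.1, c := by
      apply integral_congr
      intro s hs
      rw [hu'] at hs
      exact hall s (hsub hs)
    rw [← hx, ← e1, e2, integral_const, sub_zero]
  refine ⟨γ 0, fun w => ?_⟩
  have hw := ciInf_le (bdd_aux n u hb b hb0 (γ b)) w
  rw [hcal, hI', hz, norm_aux n b hb0] at hw
  rw [hxt, inner_smul_right, mul_div_cancel_left₀ _ hp.ne']
  linarith

theorem mem_of_redCal (n : ℕ) (u : EuclideanSpace ℝ (Fin n) → ℝ)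
    (hb : BddBelow (Set.range u)) (T b : ℝ) (p : ℝ × EuclideanSpace ℝ (Fin n))
    (hp : 0 < p.1) (h1 : p.1 ≤ b) (h2 : b < T) (y : EuclideanSpace ℝ (Fin n))
    (h : redCal n u b p.1 p.2 y) : b ∈ calibTimes n u T p := by
  have hb0 : 0 < b := hp.trans_le h1
  set c := (1 / p.1) • (p.2 - y) with hcdef
  have hz : p.2 - y = p.1 • c := by
    rw [hcdef, smul_smul, mul_one_div_cancel hp.ne', one_smul]
  refine ⟨h1, h2, fun s => y + s • c, fun _ => c, ?_, continuousOn_const, ?_, ?_⟩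
  · intro s _
    simpa using ((hasDerivAt_id s).smul_const c).const_add y
  · simp only [← hz]; abel
  · simp only [hatu, hb0, if_true, lt_irrefl, if_false, zero_smul, add_zero, integral_const,
      sub_zero, smul_eq_mul]
    apply le_antisymm
    · refine (ciInf_le (bdd_aux n u hb b hb0 (y + b • c)) y).trans ?_
      simp only [norm_aux n b hb0, sub_self, norm_zero, inner_zero_left]
      apply le_of_eq; ring
    · apply le_ciInf
      intro w
      rw [norm_aux n b hb0]
      have := h w
      rw [hz, inner_smul_right, mul_div_cancel_left₀ _ hp.ne'] at this
      linarith

theorem redCal_mono (n : ℕ) (u : EuclideanSpace ℝ (Fin n) → ℝ) (a b t : ℝ)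
    (x y : EuclideanSpace ℝ (Fin n)) (ha : 0 < a) (hab : a ≤ b) (h : redCal n u b t x y) :
    redCal n u a t x y := by
  intro w
  have := h w
  have h2 : ‖y - w‖ ^ 2 / (2 * b) ≤ ‖y - w‖ ^ 2 / (2 * a) := by gcongr
  linarith

theorem redCal_self (n : ℕ) (u : EuclideanSpace ℝ (Fin n) → ℝ) (t : ℝ) (ht : 0 < t)
    (x y : EuclideanSpace ℝ (Fin n)) : redCal n u t t x y ↔
      ∀ w, u y + ‖x - y‖ ^ 2 / (2 * t) ≤ u w + ‖x - w‖ ^ 2 / (2 * t) := by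
  have key : ∀ w, ‖x - w‖ ^ 2 / (2 * t) =
      ‖x - y‖ ^ 2 / (2 * t) + ‖y - w‖ ^ 2 / (2 * t) + inner ℝ (y - w) (x - y) / t := by
    intro w
    have : x - w = (y - w) + (x - y) := by abel
    rw [this, norm_add_sq_real]
    field_simp
    ring
  refine forall_congr' fun w => ?_
  rw [key w]
  constructor <;> intro h <;> linarith

theorem exists_redCal (n : ℕ) (u : EuclideanSpace ℝ (Fin n) → ℝ) (hlsc : LowerSemicontinuous u)
    (hb : BddBelow (Set.range u)) (t : ℝ) (ht : 0 < t) (x : EuclideanSpace ℝ (Fin n)) :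
    ∃ y, redCal n u t t x y := by
  obtain ⟨m, hm⟩ := hb
  have hm' : ∀ y, m ≤ u y := fun y => hm ⟨y, rfl⟩
  set R := Real.sqrt (2 * t * (u x - m))
  have hR : R ^ 2 = 2 * t * (u x - m) :=
    Real.sq_sqrt (mul_nonneg (by positivity) (sub_nonneg.2 (hm' x)))
  have hxm : x ∈ closedBall x R := mem_closedBall_self (Real.sqrt_nonneg _)
  have hl : LowerSemicontinuous fun y => u y + ‖x - y‖ ^ 2 / (2 * t) := by
    apply hlsc.add
    apply Continuous.lowerSemicontinuous
    fun_prop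
  obtain ⟨y, hy, hmin⟩ := LowerSemicontinuousOn.exists_isMinOn ⟨x, hxm⟩
    (isCompact_closedBall x R) (hl.lowerSemicontinuousOn _)
  refine ⟨y, (redCal_self n u t ht x y).2 fun w => ?_⟩
  by_cases hw : w ∈ closedBall x R
  · exact hmin hw
  · have h1 : u y + ‖x - y‖ ^ 2 / (2 * t) ≤ u x + ‖x - x‖ ^ 2 / (2 * t) := hmin hxm
    rw [mem_closedBall, dist_comm, dist_eq_norm, not_le] at hw
    have h2 : R ^ 2 / (2 * t) ≤ ‖x - w‖ ^ 2 / (2 * t) := by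
      have : 0 ≤ R := Real.sqrt_nonneg _
      gcongr
    rw [hR, mul_div_cancel_left₀ _ (by positivity)] at h2
    have := hm' w
    simp at h1
    linarith

open Filter Topology in
theorem redCal_limit (n : ℕ) (u : EuclideanSpace ℝ (Fin n) → ℝ) (hlsc : LowerSemicontinuous u)
    (hb : BddBelow (Set.range u)) (b : ℝ) (q : ℕ → ℝ × EuclideanSpace ℝ (Fin n))
    (p : ℝ × EuclideanSpace ℝ (Fin n)) (hp : 0 < p.1) (hq : Tendsto q atTop (𝓝 p))
    (hq0 : ∀ k, 0 < (q k).1) (hqb : ∀ k, (q k).1 ≤ b)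
    (h : ∀ k, ∃ y, redCal n u b (q k).1 (q k).2 y) : ∃ y, redCal n u b p.1 p.2 y := by
  choose y hy using h
  obtain ⟨m, hm⟩ := hb
  have hm' : ∀ y, m ≤ u y := fun y => hm ⟨y, rfl⟩
  have h1 : Tendsto (fun k => (q k).1) atTop (𝓝 p.1) := (continuous_fst.tendsto p).comp hq
  have h2 : Tendsto (fun k => (q k).2) atTop (𝓝 p.2) := (continuous_snd.tendsto p).comp hq
  -- boundedness
  have hbd : ∀ k, ‖(q k).2 - y k‖ ^ 2 ≤ 2 * (q k).1 * (u 0 - m) + ‖(q k).2‖ ^ 2 := by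
    intro k
    have := (redCal_self n u _ (hq0 k) _ _).1
      (redCal_mono n u _ _ _ _ _ (hq0 k) (hqb k) (hy k)) 0
    rw [sub_zero] at this
    have h3 := hm' (y k)
    have h4 : ‖(q k).2 - y k‖ ^ 2 / (2 * (q k).1) ≤ (u 0 - m) + ‖(q k).2‖ ^ 2 / (2 * (q k).1) := by
      linarith
    have h5 := hq0 k
    rw [div_le_iff₀ (by positivity), add_mul, div_mul_cancel₀ _ (by positivity)] at h4
    linarith
  obtain ⟨C, hC⟩ : ∃ C, ∀ k, ‖(q k).2‖ ≤ C := by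
    obtain ⟨C, hC⟩ := (Metric.isBounded_range_of_tendsto _ h2).exists_norm_le
    exact ⟨C, fun k => hC _ ⟨k, rfl⟩⟩
  set D := 2 * b * (u 0 - m) + C ^ 2 with hD
  have hyk : ∀ k, y k ∈ closedBall (0 : EuclideanSpace ℝ (Fin n)) (C + Real.sqrt D) := by
    intro k
    rw [mem_closedBall_zero_iff]
    have e1 : ‖(q k).2 - y k‖ ≤ Real.sqrt D := by
      apply Real.le_sqrt_of_sq_le
      refine (hbd k).trans ?_
      have := hC k
      have h0 := sub_nonneg.2 (hm' 0)
      have := hqb k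
      rw [hD]
      gcongr
    have e2 : ‖y k‖ ≤ ‖(q k).2‖ + ‖(q k).2 - y k‖ := by
      have := norm_sub_le (q k).2 ((q k).2 - y k)
      simpa using this
    linarith [hC k]
  obtain ⟨z, -, φ, hφ, hz⟩ := tendsto_subseq_of_bounded isBounded_closedBall hyk
  refine ⟨z, fun w => ?_⟩
  have t1 := h1.comp hφ.tendsto_atTop
  have t2 := h2.comp hφ.tendsto_atTop
  have hlim : Tendsto (fun k => u w + ‖y (φ k) - w‖ ^ 2 / (2 * b)
      + inner ℝ (y (φ k) - w) ((q (φ k)).2 - y (φ k)) / (q (φ k)).1) atTop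
      (𝓝 (u w + ‖z - w‖ ^ 2 / (2 * b) + inner ℝ (z - w) (p.2 - z) / p.1)) := by
    have hzw := hz.sub_const w
    exact (((hzw.norm.pow 2).div_const _).const_add _).add
      ((hzw.inner (t2.sub hz)).div t1 hp.ne')
  apply le_of_forall_lt
  intro c hc
  obtain ⟨c', hc1, hc2⟩ := exists_between hc
  refine hc1.trans_le (ge_of_tendsto hlim ?_)
  filter_upwards [hz.eventually (hlsc z c' hc2)] with k hk
  exact hk.le.trans (hy (φ k) w)

/-- For `u` lower semicontinuous and bounded below, the set defining the cut time is
nonempty (so `t ≤ τ(t,x) ≤ T`) and the cut time function `τ` is upper semicontinuous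
on `(0,T) × ℝⁿ`. -/
theorem cutTime_nonempty_and_upperSemicontinuous (n : ℕ)
    (u : EuclideanSpace ℝ (Fin n) → ℝ) (hlsc : LowerSemicontinuous u)
    (hb : BddBelow (Set.range u)) (T : ℝ) (hT : 0 < T) :
    (∀ p : ℝ × EuclideanSpace ℝ (Fin n), p.1 ∈ Set.Ioo 0 T →
      (calibTimes n u T p).Nonempty ∧
      p.1 ≤ cutTime n u T p ∧ cutTime n u T p ≤ T) ∧
    UpperSemicontinuousOn (cutTime n u T)
      {p : ℝ × EuclideanSpace ℝ (Fin n) | p.1 ∈ Set.Ioo 0 T} := by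
  have hself : ∀ p : ℝ × EuclideanSpace ℝ (Fin n), p.1 ∈ Set.Ioo 0 T →
      p.1 ∈ calibTimes n u T p := by
    intro p hp
    obtain ⟨y, hy⟩ := exists_redCal n u hlsc hb p.1 hp.1 p.2
    exact mem_of_redCal n u hb T p.1 p hp.1 le_rfl hp.2 y hy
  have hbdd : ∀ p, BddAbove (calibTimes n u T p) := fun p => ⟨T, fun s hs => hs.2.1.le⟩
  have hleT : ∀ p : ℝ × EuclideanSpace ℝ (Fin n), p.1 ∈ Set.Ioo 0 T → cutTime n u T p ≤ T :=
    fun p hp => csSup_le ⟨_, hself p hp⟩ fun s hs => hs.2.1.le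
  have hge : ∀ p : ℝ × EuclideanSpace ℝ (Fin n), p.1 ∈ Set.Ioo 0 T → p.1 ≤ cutTime n u T p :=
    fun p hp => le_csSup (hbdd p) (hself p hp)
  refine ⟨fun p hp => ⟨⟨_, hself p hp⟩, hge p hp, hleT p hp⟩, ?_⟩
  intro p hp a ha
  by_contra hcon
  have hfr : ∃ᶠ q in nhdsWithin p {p : ℝ × EuclideanSpace ℝ (Fin n) | p.1 ∈ Set.Ioo 0 T},
      ¬ cutTime n u T q < a := Filter.not_eventually.1 hcon
  obtain ⟨b, hb1, hb2⟩ := exists_between ha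
  have hpb : p.1 < b := (hge p hp).trans_lt hb1
  have hev : ∀ᶠ q in nhdsWithin p {p : ℝ × EuclideanSpace ℝ (Fin n) | p.1 ∈ Set.Ioo 0 T},
      q.1 ∈ Set.Ioo 0 T ∧ q.1 < b := by
    refine Filter.Eventually.and self_mem_nhdsWithin ?_
    exact nhdsWithin_le_nhds ((continuous_fst.tendsto p).eventually (gt_mem_nhds hpb))
  obtain ⟨q, hq, hqP⟩ := Filter.exists_seq_forall_of_frequently (hfr.and_eventually hev)
  have hcal : ∀ k, b < T ∧ ∃ y, redCal n u b (q k).1 (q k).2 y := by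
    intro k
    obtain ⟨h1, h2, h3⟩ := hqP k
    have h4 : b < cutTime n u T (q k) := hb2.trans_le (not_lt.1 h1)
    obtain ⟨s, hs, hbs⟩ := exists_lt_of_lt_csSup ⟨_, hself _ h2⟩ h4
    obtain ⟨y, hy⟩ := redCal_of_mem n u hb T s (q k) h2.1 hs
    exact ⟨hbs.trans hs.2.1, y, redCal_mono n u b s _ _ _ (h2.1.trans h3) hbs.le hy⟩
  obtain ⟨y, hy⟩ := redCal_limit n u hlsc hb b q p hp.1 (tendsto_nhds_of_tendsto_nhdsWithin hq)
    (fun k => (hqP k).2.1.1) (fun k => (hqP k).2.2.le) (fun k => (hcal k).2)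
  have := le_csSup (hbdd p) (mem_of_redCal n u hb T b p hp.1 hpb.le (hcal 0).1 y hy)
  exact absurd hb1 (not_lt.2 this)
end
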